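/- If a meta-algorithm A has uniform stability β with respect to a loss ℓ bounded by M, then for every meta-sample S with n tasks, every index i ∈ {1, …, n}, and every replacement sample S_i' = S_i'^tr ∪ S_i'^ts for the i-th task, |R̂(A(S), S) − R̂(A(S^i), S^i)| ≤ 2β + M/n, where S^i denotes S with the i-th task's sample S_i replaced by S_i'. -/

import Mathlib

open MeasureTheory

/-- The natural sigma-algebra on probability measures (the subtype sigma-algebra inherited
from the Giry sigma-algebra on measures). -/
noncomputable instance {Z : Type*} [MeasurableSpace Z] :
    MeasurableSpace (ProbabilityMeasure Z) :=
  MeasurableSpace.comap (fun D => (D : Measure Z)) inferInstance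

/-- Empirical test loss: average loss of hypothesis `h` on a test set of `k` points. -/
noncomputable def hatL {H Z : Type*} {k : ℕ} (ℓ : H → Z → ℝ) (h : H) (Sts : Fin k → Z) : ℝ :=
  (1 / (k : ℝ)) * ∑ j, ℓ h (Sts j)

/-- Transfer risk of an inner algorithm `alg` w.r.t. a task distribution `P`. -/
noncomputable def risk {H Z : Type*} [MeasurableSpace Z] {m : ℕ}
    (P : Measure (ProbabilityMeasure Z)) (ℓ : H → Z → ℝ)
    (alg : (Fin m → Z) → H) : ℝ :=
  ∫ D, ∫ Str, ∫ z, ℓ (alg Str) z ∂(D : Measure Z)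
      ∂(Measure.pi fun _ : Fin m => (D : Measure Z)) ∂P

/-- Empirical multi-task error of the inner algorithm `alg` on the meta-sample `S`. -/
noncomputable def empErr {H Z : Type*} {m k n : ℕ} (ℓ : H → Z → ℝ)
    (alg : (Fin m → Z) → H) (S : Fin n → (Fin m → Z) × (Fin k → Z)) : ℝ :=
  (1 / (n : ℝ)) * ∑ i, hatL ℓ (alg (S i).1) (S i).2

/-- Uniform stability of a meta-algorithm `A`: deleting any one task's sample from the
meta-sample changes the empirical test loss of the learned inner algorithm by at most `β`,
for every task, training set and test set. -/
def UniformStability {H Z : Type*} {m k : ℕ} (ℓ : H → Z → ℝ)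
    (A : ∀ n : ℕ, (Fin n → (Fin m → Z) × (Fin k → Z)) → (Fin m → Z) → H) (β : ℝ) : Prop :=
  ∀ (n : ℕ) (S : Fin (n + 1) → (Fin m → Z) × (Fin k → Z)) (i : Fin (n + 1))
    (Str : Fin m → Z) (Sts : Fin k → Z),
    |hatL ℓ (A (n + 1) S Str) Sts - hatL ℓ (A n (i.removeNth S) Str) Sts| ≤ β

/-- Distribution of one task's sample `(Sᵗʳ, Sᵗˢ)`: draw a task `D ~ P`, then draw the
training set `~ Dᵐ` and the test set `~ Dᵏ` independently. -/
noncomputable def sampleDist {Z : Type*} [MeasurableSpace Z] (m k : ℕ)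
    (P : Measure (ProbabilityMeasure Z)) : Measure ((Fin m → Z) × (Fin k → Z)) :=
  P.bind fun D =>
    (Measure.pi fun _ : Fin m => (D : Measure Z)).prod
      (Measure.pi fun _ : Fin k => (D : Measure Z))

/-- Distribution of a meta-sample consisting of `n` i.i.d. tasks' samples. -/
noncomputable def metaDist {Z : Type*} [MeasurableSpace Z] (m k n : ℕ)
    (P : Measure (ProbabilityMeasure Z)) : Measure (Fin n → (Fin m → Z) × (Fin k → Z)) :=
  Measure.pi fun _ : Fin n => sampleDist m k P

theorem hatL_mem_Icc {H Z : Type*} {k : ℕ} {ℓ : H → Z → ℝ} {M : ℝ} (hM : 0 ≤ M)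
    (hℓ : ∀ h z, ℓ h z ∈ Set.Icc 0 M) (h : H) (Sts : Fin k → Z) :
    hatL ℓ h Sts ∈ Set.Icc 0 M := by
  unfold hatL
  refine ⟨mul_nonneg (by positivity) (Finset.sum_nonneg fun j _ => (hℓ h (Sts j)).1), ?_⟩
  rcases Nat.eq_zero_or_pos k with rfl | hk
  · simpa using hM
  · have hsum : ∑ j, ℓ h (Sts j) ≤ k * M := by
      simpa using Finset.sum_le_sum fun j (_ : j ∈ Finset.univ) => (hℓ h (Sts j)).2
    rw [one_div_mul_eq_div, div_le_iff₀ (by positivity)]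
    linarith

theorem UniformStability.abs_hatL_update_sub_le {H Z : Type*} {m k : ℕ} {ℓ : H → Z → ℝ}
    {A : ∀ n : ℕ, (Fin n → (Fin m → Z) × (Fin k → Z)) → (Fin m → Z) → H} {β : ℝ}
    (hA : UniformStability ℓ A β) {n : ℕ} (S : Fin (n + 1) → (Fin m → Z) × (Fin k → Z))
    (i : Fin (n + 1)) (S' : (Fin m → Z) × (Fin k → Z)) (Str : Fin m → Z) (Sts : Fin k → Z) :
    |hatL ℓ (A (n + 1) S Str) Sts - hatL ℓ (A (n + 1) (Function.update S i S') Str) Sts|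
      ≤ 2 * β := by
  have h₁ := hA n S i Str Sts
  have h₂ := hA n (Function.update S i S') i Str Sts
  rw [Fin.removeNth_update] at h₂
  rw [abs_le] at *
  constructor <;> linarith [h₁.1, h₁.2, h₂.1, h₂.2]

/-- If the meta-algorithm `A` has uniform stability `β` w.r.t. a loss `ℓ` bounded by `M`,
then replacing any one task's sample in a meta-sample of `n + 1` tasks changes the empirical
multi-task error by at most `2β + M/(n+1)`:
`|R̂(A(S), S) − R̂(A(Sⁱ), Sⁱ)| ≤ 2β + M/n` with `n` the number of tasks. -/
theorem empErr_replace_stability {H Z : Type*} [MeasurableSpace Z] {m k : ℕ}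
    (ℓ : H → Z → ℝ) (M : ℝ) (hM : 0 < M)
    (hℓ : ∀ h z, ℓ h z ∈ Set.Icc 0 M)
    (A : ∀ n : ℕ, (Fin n → (Fin m → Z) × (Fin k → Z)) → (Fin m → Z) → H)
    (β : ℝ) (hA : UniformStability ℓ A β) :
    ∀ (n : ℕ) (S : Fin (n + 1) → (Fin m → Z) × (Fin k → Z)) (i : Fin (n + 1))
      (S' : (Fin m → Z) × (Fin k → Z)),
      |empErr ℓ (A (n + 1) S) S -
          empErr ℓ (A (n + 1) (Function.update S i S')) (Function.update S i S')|
        ≤ 2 * β + M / (n + 1) := by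
  intro n S i S'
  have hβ : 0 ≤ β := (abs_nonneg _).trans (hA n S i S'.1 S'.2)
  have hterm : ∀ j,
      |hatL ℓ (A (n + 1) S (S j).1) (S j).2 -
          hatL ℓ (A (n + 1) (Function.update S i S') (Function.update S i S' j).1)
            (Function.update S i S' j).2| ≤ 2 * β + if j = i then M else 0 := by
    intro j
    split_ifs with hj
    · refine (abs_sub_le_of_nonneg_of_le (hatL_mem_Icc hM.le hℓ _ _).1
        (hatL_mem_Icc hM.le hℓ _ _).2 (hatL_mem_Icc hM.le hℓ _ _).1
        (hatL_mem_Icc hM.le hℓ _ _).2).trans ?_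
      linarith
    · rw [Function.update_of_ne hj, add_zero]
      exact hA.abs_hatL_update_sub_le S i S' _ _
  have hsum := (Finset.abs_sum_le_sum_abs _ Finset.univ).trans
    (Finset.sum_le_sum fun j (_ : j ∈ Finset.univ) => hterm j)
  have hn : (0 : ℝ) < n + 1 := by positivity
  simp only [Finset.sum_add_distrib, Finset.sum_ite_eq', Finset.mem_univ, if_true,
    Finset.sum_const, Finset.card_univ, Fintype.card_fin, nsmul_eq_mul, Nat.cast_add,
    Nat.cast_one] at hsum
  unfold empErr
  rw [← mul_sub, ← Finset.sum_sub_distrib, abs_mul, Nat.cast_add, Nat.cast_one,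
    abs_of_pos (by positivity), one_div_mul_eq_div, div_le_iff₀ hn, add_mul,
    div_mul_cancel₀ _ hn.ne']
  linarith
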